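/- For all k, n ∈ ℕ with k ≤ n, the following identity holds in ℤ[q]: Σ_{j=0}^{k} (−1)^j q^{j(j−1)/2} binom_{q²}(n−j, k−j) binom_q(n,j) = q^{k²} (q−1)^k binom_q(n, 2k) (2k−1)_q!!, where (2k−1)_q!! := ∏_{r=1}^{k} (2r−1)_q (empty product equal to 1 for k = 0). -/

import Mathlib

open Finset

noncomputable section

/-- The base field `ℚ(q)` of rational functions over `ℚ`. -/
abbrev K : Type := RatFunc ℚ

/-- The indeterminate `q`. -/
def q : K := RatFunc.X

/-- The `x`-number `(n)_x = (x^n - 1)/(x - 1)`. -/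
def qn (x : K) (n : ℕ) : K := (x ^ n - 1) / (x - 1)

/-- The `x`-factorial `(n)_x!`. -/
def qnFact (x : K) (n : ℕ) : K := ∏ r ∈ Finset.Icc 1 n, qn x r

/-- The `x`-binomial coefficient `binom_x(n,s)`, zero when `s > n`. -/
def qBinom (x : K) (n s : ℕ) : K :=
  if s ≤ n then qnFact x n / (qnFact x s * qnFact x (n - s)) else 0

/-- The balanced `q`-integer `[n]_q = (q^n - q^{-n})/(q - q^{-1})`. -/
def qint (n : ℕ) : K := (q ^ n - q⁻¹ ^ n) / (q - q⁻¹)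

/-- The balanced `q`-factorial `[n]_q!`. -/
def qintFact (n : ℕ) : K := ∏ r ∈ Finset.Icc 1 n, qint r

variable {A : Type*} [Ring A] [Algebra K A]

/-- The `q`-divided power `X^{(n)} = X^n / [n]_q!`. -/
def dp (X : A) (n : ℕ) : A := (qintFact n)⁻¹ • X ^ n

/-- The `q`-binomial coefficient `C_q(X; c, n) = ∏_{s=1}^n (q^{c+1-s} X - 1)/(q^s - 1)`. -/
def Cq (X : A) (c : ℤ) : ℕ → A
  | 0 => 1
  | n + 1 => (q ^ ((n : ℤ) + 1) - 1)⁻¹ • (Cq X c n * (q ^ (c - (n : ℤ)) • X - 1))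

/-- The bracket `{X; c | n, r} = Σ_{s=0}^r q^{s(s+1)/2} binom_q(r,s) C_q(X; c+s, n-r)`. -/
def Sq (X : A) (c : ℤ) (n r : ℕ) : A :=
  ∑ s ∈ Finset.range (r + 1),
    (q ^ (s * (s + 1) / 2) * qBinom q r s) • Cq X (c + (s : ℤ)) (n - r)

end

noncomputable section

/-- The odd `q`-double-factorial `(2k-1)_q!! = ∏_{r=1}^{k} (2r-1)_q`. -/
def qOddFact (k : ℕ) : K := ∏ r ∈ Finset.Icc 1 k, qn q (2 * r - 1)

theorem q_ne_zero : q ≠ 0 := RatFunc.X_ne_zero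

theorem q_pow_ne_one {n : ℕ} (hn : n ≠ 0) : q ^ n ≠ 1 := by
  intro h
  have h' : (Polynomial.X ^ n : Polynomial ℚ) = 1 := by
    apply RatFunc.algebraMap_injective ℚ
    simpa [q, RatFunc.algebraMap_X] using h
  have := congrArg Polynomial.natDegree h'
  simp at this
  exact hn this

theorem one_add_q_pow_ne_zero (n : ℕ) : 1 + q ^ n ≠ 0 := by
  intro h
  rcases eq_or_ne n 0 with rfl | hn
  · norm_num at h
  · exact q_pow_ne_one (mul_ne_zero hn two_ne_zero)
      (by rw [pow_mul]; linear_combination (q ^ n - 1) * h)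

theorem q_sub_one_ne_zero : q - 1 ≠ 0 :=
  sub_ne_zero.2 (by simpa using q_pow_ne_one one_ne_zero)

theorem qn_ne_zero {n : ℕ} (hn : n ≠ 0) : qn q n ≠ 0 :=
  div_ne_zero (sub_ne_zero.2 (q_pow_ne_one hn)) q_sub_one_ne_zero

theorem qnFact_zero (x : K) : qnFact x 0 = 1 := by simp [qnFact]

theorem qnFact_succ (x : K) (n : ℕ) : qnFact x (n + 1) = qnFact x n * qn x (n + 1) := by
  rw [qnFact, Finset.prod_Icc_succ_top (by omega), qnFact]

theorem qnFact_ne_zero (n : ℕ) : qnFact q n ≠ 0 :=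
  Finset.prod_ne_zero_iff.2 fun r hr => qn_ne_zero (by simp at hr; omega)

theorem qBinom_of_lt (x : K) {n s : ℕ} (h : n < s) : qBinom x n s = 0 :=
  if_neg (by omega)

theorem qBinom_add (x : K) (m s : ℕ) :
    qBinom x (s + m) s = qnFact x (s + m) / (qnFact x s * qnFact x m) := by
  rw [qBinom, if_pos (by omega), Nat.add_sub_cancel_left]

theorem qBinom_zero_right (n : ℕ) : qBinom q n 0 = 1 := by
  simp [qBinom, qnFact_zero, qnFact_ne_zero]

theorem qBinom_self (n : ℕ) : qBinom q n n = 1 := by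
  simp [qBinom, qnFact_zero, qnFact_ne_zero]

/-- The `q`-Pascal rule. -/
theorem qBinom_succ_succ {n s : ℕ} (h : s ≤ n) :
    qBinom q (n + 1) (s + 1) = qBinom q n (s + 1) + q ^ (n - s) * qBinom q n s := by
  obtain ⟨m, rfl⟩ := Nat.exists_eq_add_of_le h
  cases m with
  | zero => simp [qBinom_self, qBinom_of_lt]
  | succ m =>
    rw [show s + (m + 1) + 1 = (s + 1) + (m + 1) by ring, qBinom_add, qBinom_add,
      show s + (m + 1) = (s + 1) + m by ring, qBinom_add,
      show s + 1 + m - s = m + 1 by omega, show s + 1 + (m + 1) = (s + 1 + m) + 1 by ring,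
      qnFact_succ q (s + 1 + m), qnFact_succ q s, qnFact_succ q m]
    have h1 := qnFact_ne_zero s
    have h2 := qnFact_ne_zero m
    have h3 := qn_ne_zero (Nat.succ_ne_zero s)
    have h4 := qn_ne_zero (Nat.succ_ne_zero m)
    have key : qn q (s + 1 + m + 1) = qn q (m + 1) + q ^ (m + 1) * qn q (s + 1) := by
      have := q_sub_one_ne_zero
      simp only [qn]
      field_simp
      ring
    simp only [Nat.succ_eq_add_one] at h3 h4
    rw [key]
    field_simp

/-- The `q`-difference `∏_{i < k} (E - q^i)` of `f` at `m`, where `E` is the shift,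
in expanded form. -/
def qDiff (f : ℕ → K) (k m : ℕ) : K :=
  ∑ j ∈ Finset.range (k + 1),
    (-1) ^ j * q ^ (j * (j - 1) / 2) * qBinom q k j * f (m + (k - j))

theorem qDiff_zero (f : ℕ → K) (m : ℕ) : qDiff f 0 m = f m := by
  simp [qDiff, qBinom_self]

theorem qDiff_succ (f : ℕ → K) (k m : ℕ) :
    qDiff f (k + 1) m = qDiff f k (m + 1) - q ^ k * qDiff f k m := by
  have hshift : qDiff f k (m + 1) = ∑ j ∈ Finset.range (k + 1 + 1),
      (-1) ^ j * q ^ (j * (j - 1) / 2) * qBinom q k j * f (m + (k + 1 - j)) := by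
    rw [Finset.sum_range_succ, qBinom_of_lt q (Nat.lt_succ_self k), mul_zero, zero_mul, add_zero]
    refine Finset.sum_congr rfl fun j hj => ?_
    rw [Finset.mem_range] at hj
    rw [show m + 1 + (k - j) = m + (k + 1 - j) by omega]
  rw [hshift, qDiff, qDiff, Finset.sum_range_succ', Finset.sum_range_succ' _ (k + 1),
    Finset.mul_sum, qBinom_zero_right, qBinom_zero_right, add_sub_right_comm,
    ← Finset.sum_sub_distrib]
  congr 1
  refine Finset.sum_congr rfl fun j hj => ?_
  rw [Finset.mem_range] at hj
  have hk : q ^ k = q ^ j * q ^ (k - j) := by rw [← pow_add]; congr 1; omega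
  rw [qBinom_succ_succ (by omega), Nat.triangle_succ, Nat.add_sub_add_right, hk]
  ring

/-- The product `∏_{i=1}^{m} (1 + q^i)`. -/
def onePlusProd (m : ℕ) : K := ∏ i ∈ Finset.range m, (1 + q ^ (i + 1))

theorem onePlusProd_succ (m : ℕ) :
    onePlusProd (m + 1) = onePlusProd m * (1 + q ^ (m + 1)) :=
  Finset.prod_range_succ _ _

theorem onePlusProd_ne_zero (m : ℕ) : onePlusProd m ≠ 0 :=
  Finset.prod_ne_zero_iff.2 fun _ _ => one_add_q_pow_ne_zero _

/-- The `q`-differences of a solution of a first order recurrence. -/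
theorem qDiff_eq (f : ℕ → K) (y : K)
    (hf : ∀ m, f (m + 1) * (1 + q ^ (m + 1)) = f m * (1 + y * q ^ (m + 1))) (k m : ℕ) :
    qDiff f k m * onePlusProd (m + k) =
      q ^ (k * (k + 1) / 2) * (∏ i ∈ Finset.range k, (y - q ^ i)) * q ^ (k * m) * f m *
        onePlusProd m := by
  induction k generalizing m with
  | zero => simp [qDiff_zero]
  | succ k ih =>
    have h1 := ih (m + 1)
    have h2 := ih m
    have hm := hf m
    have htri : (k + 1) * (k + 1 + 1) / 2 = k * (k + 1) / 2 + (k + 1) := by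
      have := Nat.triangle_succ (k + 1)
      simp only [Nat.add_sub_cancel] at this
      rw [mul_comm, this, mul_comm]
    rw [qDiff_succ, htri, Finset.prod_range_succ]
    rw [show m + 1 + k = m + (k + 1) by ring, onePlusProd_succ m] at h1
    rw [sub_mul, h1, ← add_assoc, onePlusProd_succ]
    set c := q ^ (k * (k + 1) / 2)
    set p := ∏ i ∈ Finset.range k, (y - q ^ i)
    linear_combination (-(q ^ k * (1 + q ^ (m + k + 1)))) * h2 +
      c * p * q ^ (k * (m + 1)) * onePlusProd m * hm

theorem qn_sq (m : ℕ) : qn (q ^ 2) m * (1 + q) = qn q m * (1 + q ^ m) := by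
  have h := q_sub_one_ne_zero
  have h' : q ^ 2 - 1 ≠ 0 := sub_ne_zero.2 (q_pow_ne_one two_ne_zero)
  simp only [qn]
  rw [← pow_mul, mul_comm 2 m, pow_mul]
  field_simp
  ring

theorem qnFact_sq (m : ℕ) :
    qnFact (q ^ 2) m = qnFact q m * onePlusProd m / (1 + q) ^ m := by
  have h : 1 + q ≠ 0 := by simpa using one_add_q_pow_ne_zero 1
  induction m with
  | zero => simp [qnFact_zero, onePlusProd]
  | succ m ih =>
    have := qn_sq (m + 1)
    rw [qnFact_succ, ih, qnFact_succ, onePlusProd_succ]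
    field_simp
    linear_combination qnFact q m * onePlusProd m * (1 + q) ^ m * this

theorem qnFact_two_mul (k : ℕ) :
    qnFact q (2 * k) = qOddFact k * qnFact q k * onePlusProd k := by
  induction k with
  | zero => simp [qnFact_zero, onePlusProd, qOddFact]
  | succ k ih =>
    have h : qn q (2 * k + 1 + 1) = qn q (k + 1) * (1 + q ^ (k + 1)) := by
      simp only [qn]
      ring
    have ho : qOddFact (k + 1) = qOddFact k * qn q (2 * k + 1) := by
      rw [qOddFact, Finset.prod_Icc_succ_top (by omega), qOddFact]
      rfl
    rw [show 2 * (k + 1) = 2 * k + 1 + 1 by ring, qnFact_succ, qnFact_succ, ih, h, ho,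
      qnFact_succ, onePlusProd_succ]
    ring

theorem qBinom_sq_mul_qBinom (j l d : ℕ) :
    qBinom (q ^ 2) (l + d) l * qBinom q (j + (l + d)) j =
      qBinom q (j + l + d) (j + l) * (qBinom q (j + l) j *
        (onePlusProd (d + l) / (onePlusProd l * onePlusProd d))) := by
  have h : 1 + q ≠ 0 := by simpa using one_add_q_pow_ne_zero 1
  rw [qBinom_add, qBinom_add, qBinom_add, qBinom_add, qnFact_sq, qnFact_sq, qnFact_sq,
    pow_add, add_comm d l, add_assoc j l d]
  have h1 := qnFact_ne_zero j
  have h2 := qnFact_ne_zero l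
  have h3 := qnFact_ne_zero d
  have h4 := qnFact_ne_zero (l + d)
  have h5 := qnFact_ne_zero (j + l)
  have h6 := onePlusProd_ne_zero l
  have h7 := onePlusProd_ne_zero d
  field_simp

theorem prod_q_pow_sub (k d : ℕ) :
    (∏ i ∈ Finset.range k, (q ^ (k + d) - q ^ i)) * qnFact q d =
      q ^ (k * (k - 1) / 2) * (q - 1) ^ k * qnFact q (k + d) := by
  induction k generalizing d with
  | zero => simp
  | succ k ih =>
    have hn : q ^ (d + 1) - 1 = (q - 1) * qn q (d + 1) := by
      rw [qn, mul_div_cancel₀ _ q_sub_one_ne_zero]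
    have h := ih (d + 1)
    rw [qnFact_succ, ← add_assoc, show k + d + 1 = k + 1 + d by ring] at h
    rw [Finset.prod_range_succ, Nat.triangle_succ]
    have : q ^ (k + 1 + d) - q ^ k = q ^ k * ((q - 1) * qn q (d + 1)) := by rw [← hn]; ring
    rw [this]
    linear_combination q ^ k * (q - 1) * h

theorem statement10 (k n : ℕ) (hk : k ≤ n) :
    ∑ j ∈ Finset.range (k + 1),
        (-1 : K) ^ j * q ^ (j * (j - 1) / 2) *
          qBinom (q ^ 2) (n - j) (k - j) * qBinom q n j =
      q ^ (k ^ 2) * (q - 1) ^ k * qBinom q n (2 * k) * qOddFact k := by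
  obtain ⟨d, rfl⟩ := Nat.exists_eq_add_of_le hk
  set f : ℕ → K := fun m => onePlusProd (d + m) / (onePlusProd m * onePlusProd d) with hf
  have hsum : ∑ j ∈ Finset.range (k + 1), (-1 : K) ^ j * q ^ (j * (j - 1) / 2) *
      qBinom (q ^ 2) (k + d - j) (k - j) * qBinom q (k + d) j =
        qBinom q (k + d) k * qDiff f k 0 := by
    rw [qDiff, Finset.mul_sum]
    refine Finset.sum_congr rfl fun j hj => ?_
    obtain ⟨l, rfl⟩ := Nat.exists_eq_add_of_le (Nat.lt_succ_iff.1 (Finset.mem_range.1 hj))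
    have h := qBinom_sq_mul_qBinom j l d
    rw [← add_assoc] at h
    rw [show j + l + d - j = l + d by omega, Nat.add_sub_cancel_left, zero_add]
    linear_combination (-1 : K) ^ j * q ^ (j * (j - 1) / 2) * h
  have hrec : ∀ m, f (m + 1) * (1 + q ^ (m + 1)) = f m * (1 + q ^ d * q ^ (m + 1)) := by
    intro m
    have h1 := onePlusProd_ne_zero m
    have h2 := onePlusProd_ne_zero d
    have h3 := one_add_q_pow_ne_zero (m + 1)
    simp only [hf]
    rw [← add_assoc, onePlusProd_succ, onePlusProd_succ, ← pow_add, ← add_assoc]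
    field_simp
  have hdiff := qDiff_eq f (q ^ d) hrec k 0
  have hW0 : onePlusProd 0 = 1 := by simp [onePlusProd]
  have hf0 : f 0 = 1 := by simp [hf, hW0, onePlusProd_ne_zero d]
  rw [hf0, hW0, zero_add, mul_zero, pow_zero, mul_one, mul_one, mul_one] at hdiff
  rw [hsum]
  apply mul_right_cancel₀ (onePlusProd_ne_zero k)
  rw [mul_assoc, hdiff]
  rcases lt_or_ge d k with hdk | hkd
  · rw [Finset.prod_eq_zero (Finset.mem_range.2 hdk) (sub_self _),
      qBinom_of_lt q (show k + d < 2 * k by omega)]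
    simp
  · obtain ⟨e, rfl⟩ := Nat.exists_eq_add_of_le hkd
    have hpow : q ^ (k ^ 2) = q ^ (k * (k + 1) / 2) * q ^ (k * (k - 1) / 2) := by
      rw [← pow_add]
      congr 1
      have := Nat.triangle_succ k
      rw [Nat.add_sub_cancel, mul_comm] at this
      have h2 := Nat.div_mul_cancel (Nat.even_mul_pred_self k).two_dvd
      cases k with
      | zero => rfl
      | succ k =>
        simp only [Nat.add_sub_cancel] at this h2 ⊢
        nlinarith
    have hprod := eq_div_of_mul_eq (qnFact_ne_zero e) (prod_q_pow_sub k e)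
    rw [hprod, qBinom_add, ← add_assoc, ← two_mul, qBinom_add, qnFact_two_mul k, hpow]
    have h1 := qnFact_ne_zero k
    have h2 := qnFact_ne_zero e
    have h3 := qnFact_ne_zero (k + e)
    have h4 := onePlusProd_ne_zero k
    have h5 : qOddFact k ≠ 0 :=
      Finset.prod_ne_zero_iff.2 fun r hr => qn_ne_zero (by simp at hr; omega)
    field_simp

end
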